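/- Let E := EuclideanSpace ℝ (Fin 3) and let φ : E → ℝ. The following are equivalent: (i) there exists a C^∞ function F : ℝ × E → ℝ such that φ(y) = F(‖y‖, y) for all y ∈ E; (ii) there exist C^∞ functions f, g : E → ℝ such that φ(y) = f(y) + ‖y‖·g(y) for all y ∈ E. -/

import Mathlib

open Set Filter Topology MeasureTheory

theorem cone_param_integral {H : Type} [NormedAddCommGroup H] [NormedSpace ℝ H] [ProperSpace H]
    (n : ℕ) : ∀ {G : Type} [NormedAddCommGroup G] [NormedSpace ℝ G] [CompleteSpace G]
    (P : H × ℝ → G), ContDiff ℝ (⊤ : ℕ∞) P →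
    ContDiff ℝ n (fun x => ∫ s in (0:ℝ)..1, P (x, s)) := by
  induction n with
  | zero =>
    intro G _ _ _ P hP
    have hc := hP.continuous
    refine contDiff_zero.2 ?_
    apply intervalIntegral.continuous_parametric_intervalIntegral_of_continuous'
    exact hc
  | succ n ih =>
    intro G _ _ _ P hP
    have hc := hP.continuous
    have hd : ContDiff ℝ (⊤ : ℕ∞) (fderiv ℝ P) := hP.fderiv_right (by simp)
    set P' : H × ℝ → (H →L[ℝ] G) := fun p =>
      (fderiv ℝ P p).comp (ContinuousLinearMap.inl ℝ H ℝ) with hP'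
    have hP's : ContDiff ℝ (⊤ : ℕ∞) P' := hd.clm_comp contDiff_const
    have hc' := hP's.continuous
    have hder : ∀ x s, HasFDerivAt (fun x => P (x, s)) (P' (x, s)) x := by
      intro x s
      have h1 : HasFDerivAt P (fderiv ℝ P (x, s)) (x, s) :=
        (hP.differentiable (by simp) _).hasFDerivAt
      exact h1.comp x (hasFDerivAt_prodMk_left x s)
    push_cast
    refine contDiff_succ_iff_hasFDerivAt.2 ⟨fun x => ∫ s in (0:ℝ)..1, P' (x, s), ih P' hP's, ?_⟩
    intro x
    have hK : IsCompact (Metric.closedBall x 1 ×ˢ Icc (0:ℝ) 1) :=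
      (isCompact_closedBall x 1).prod isCompact_Icc
    obtain ⟨C, hC⟩ := hK.exists_bound_of_continuousOn hc'.continuousOn
    refine intervalIntegral.hasFDerivAt_integral_of_dominated_of_fderiv_le
      (F := fun x s => P (x, s)) (F' := fun x s => P' (x, s)) (bound := fun _ => C)
      (Metric.closedBall_mem_nhds x one_pos) ?_ ?_ ?_ ?_ ?_ ?_
    · exact Eventually.of_forall fun y =>
        (hc.comp (by fun_prop : Continuous fun s : ℝ => (y, s))).aestronglyMeasurable
    · exact (hc.comp (by fun_prop : Continuous fun s : ℝ => (x, s))).intervalIntegrable _ _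
    · exact (hc'.comp (by fun_prop : Continuous fun s : ℝ => (x, s))).aestronglyMeasurable
    · refine Eventually.of_forall fun t ht y hy => hC (y, t) ⟨hy, ?_⟩
      rw [uIoc_of_le zero_le_one] at ht
      exact ⟨ht.1.le, ht.2⟩
    · simp
    · exact Eventually.of_forall fun t _ y _ => hder y t

theorem cone_hadamard {E : Type} [NormedAddCommGroup E] [NormedSpace ℝ E] [ProperSpace E]
    {G : Type} [NormedAddCommGroup G] [NormedSpace ℝ G] [CompleteSpace G]
    (u : ℝ × E → G) (hu : ContDiff ℝ (⊤ : ℕ∞) u) (hodd : ∀ t y, u (-t, y) = -u (t, y)) :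
    ∃ k : ℝ × E → G, ContDiff ℝ (⊤ : ℕ∞) k ∧ (∀ t y, k (-t, y) = k (t, y)) ∧
      ∀ t y, u (t, y) = t • k (t, y) := by
  have hd : ContDiff ℝ (⊤ : ℕ∞) (fderiv ℝ u) := hu.fderiv_right (by simp)
  set P : (ℝ × E) × ℝ → G := fun q => fderiv ℝ u (q.2 * q.1.1, q.1.2) (1, 0) with hPdef
  have hP : ContDiff ℝ (⊤ : ℕ∞) P := by
    refine ContDiff.clm_apply (hd.comp ?_) contDiff_const
    fun_prop
  have hu0 : ∀ y, u (0, y) = 0 := by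
    intro y
    have := hodd 0 y
    rw [neg_zero] at this
    have h2 : (2 : ℝ) • u (0, y) = 0 := by
      rw [two_smul]
      nth_rewrite 1 [this]
      exact neg_add_cancel _
    exact (smul_eq_zero.1 h2).resolve_left two_ne_zero
  have key : ∀ t y, u (t, y) = t • ∫ s in (0:ℝ)..1, P ((t, y), s) := by
    intro t y
    have hder : ∀ s : ℝ, HasDerivAt (fun s : ℝ => u (s * t, y)) (t • P ((t, y), s)) s := by
      intro s
      have h1 : HasFDerivAt u (fderiv ℝ u (s * t, y)) (s * t, y) :=
        (hu.differentiable (by simp) _).hasFDerivAt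
      have h2 : HasDerivAt (fun s : ℝ => (s * t, y)) (t, (0 : E)) s := by
        simpa using ((hasDerivAt_id s).mul_const t).prodMk (hasDerivAt_const s y)
      have h3 : HasDerivAt (fun s : ℝ => u (s * t, y)) (fderiv ℝ u (s * t, y) (t, 0)) s :=
        h1.comp_hasDerivAt s h2
      convert h3 using 1
      change t • fderiv ℝ u (s * t, y) (1, 0) = _
      rw [← map_smul]
      simp
    have hc : Continuous fun s : ℝ => t • P ((t, y), s) :=
      (hP.continuous.comp (by fun_prop : Continuous fun s : ℝ => ((t, y), s))).const_smul t
    have := intervalIntegral.integral_eq_sub_of_hasDerivAt (a := 0) (b := 1)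
      (fun s _ => hder s) (hc.intervalIntegrable _ _)
    rw [intervalIntegral.integral_smul] at this
    rw [this]
    simp [hu0]
  refine ⟨fun p => ∫ s in (0:ℝ)..1, P (p, s), ?_, ?_, key⟩
  · exact contDiff_infty.2 fun n => cone_param_integral n P hP
  · intro t y
    by_cases ht : t = 0
    · simp [ht]
    · have h1 := hodd t y
      rw [key, key, neg_smul, neg_inj] at h1
      exact smul_right_injective G ht h1

theorem cone_even {E : Type} [NormedAddCommGroup E] [InnerProductSpace ℝ E] [ProperSpace E]
    (n : ℕ) : ∀ {G : Type} [NormedAddCommGroup G] [NormedSpace ℝ G] [CompleteSpace G]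
    (h : ℝ × E → G), ContDiff ℝ (⊤ : ℕ∞) h → (∀ t y, h (-t, y) = h (t, y)) →
    ContDiff ℝ n (fun y => h (‖y‖, y)) := by
  induction n with
  | zero =>
    intro G _ _ _ h hs _
    refine contDiff_zero.2 ?_
    exact hs.continuous.comp (by fun_prop)
  | succ n ih =>
    intro G _ _ _ h hs heven
    have hd : ContDiff ℝ (⊤ : ℕ∞) (fderiv ℝ h) := hs.fderiv_right (by simp)
    have hfd : ∀ p, HasFDerivAt h (fderiv ℝ h p) p := fun p =>
      (hs.differentiable (by simp) _).hasFDerivAt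
    have hpar : ∀ t y a v, fderiv ℝ h (-t, y) (a, v) = fderiv ℝ h (t, y) (-a, v) := by
      intro t y a v
      let σ : ℝ × E →L[ℝ] ℝ × E :=
        (-ContinuousLinearMap.id ℝ ℝ).prodMap (ContinuousLinearMap.id ℝ E)
      have h1 : HasFDerivAt h ((fderiv ℝ h (t, y)).comp σ) (-t, y) := by
        have h2 : HasFDerivAt h (fderiv ℝ h (t, y)) (σ (-t, y)) := by
          have : σ (-t, y) = (t, y) := by simp [σ]
          rw [this]; exact hfd _
        have h3 := h2.comp (-t, y) σ.hasFDerivAt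
        have h4 : h ∘ σ = h := by
          ext ⟨a, b⟩
          simpa [σ] using heven a b
        rwa [h4] at h3
      rw [h1.fderiv]
      simp [σ]
    obtain ⟨k, hk, hkeven, hkey⟩ := cone_hadamard (fun p => fderiv ℝ h p (1, 0))
      (hd.clm_apply contDiff_const) (by
        intro t y
        rw [hpar, ← map_neg]
        simp)
    set h' : ℝ × E → (E →L[ℝ] G) := fun p =>
      (fderiv ℝ h p).comp (ContinuousLinearMap.inr ℝ ℝ E) +
        (innerSL ℝ p.2).smulRight (k p) with hh'
    have hs' : ContDiff ℝ (⊤ : ℕ∞) h' := by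
      refine (hd.clm_comp contDiff_const).add ?_
      exact ContDiff.smulRight ((innerSL ℝ).contDiff.comp contDiff_snd) hk
    have heven' : ∀ t y, h' (-t, y) = h' (t, y) := by
      intro t y
      ext v
      simp [hh', hkeven, hpar]
    push_cast
    refine contDiff_succ_iff_hasFDerivAt.2 ⟨fun y => h' (‖y‖, y), ih h' hs' heven', ?_⟩
    intro y
    have hsplit : ∀ p a v, fderiv ℝ h p (a, v) =
        a • fderiv ℝ h p (1, 0) + fderiv ℝ h p (0, v) := by
      intro p a v
      rw [← map_smul, ← map_add]
      simp
    by_cases hy : y = 0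
    · subst hy
      have h0 : fderiv ℝ h (0, (0:E)) (1, 0) = 0 := by simpa using hkey 0 0
      have h1 := (hfd (0, (0:E))).isLittleO
      have htend : Tendsto (fun y : E => (‖y‖, y)) (𝓝 0) (𝓝 (0, (0:E))) := by
        have : Continuous (fun y : E => (‖y‖, y)) := by fun_prop
        simpa using this.tendsto 0
      have h2 := h1.comp_tendsto htend
      refine HasFDerivAt.of_isLittleO ?_
      have h3 := h2.trans_isBigO (k := fun y : E => y - 0) (by
        refine Asymptotics.IsBigO.of_bound 1 (Eventually.of_forall fun y => ?_)
        simp [Prod.norm_def])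
      refine h3.congr_left fun x => ?_
      have h00 : fderiv ℝ h (0, (0:E)) (0, 0) = 0 := map_zero _
      simp [hh', hsplit (0, 0) ‖x‖ x, h0, h00]
    · have hn : HasFDerivAt (fun y : E => ‖y‖) (‖y‖⁻¹ • innerSL ℝ y) y := by
        have hny : ‖y‖ ≠ 0 := norm_ne_zero_iff.2 hy
        have h1 := (hasStrictFDerivAt_norm_sq y).hasFDerivAt.sqrt (by positivity)
        simp only [Real.sqrt_sq (norm_nonneg _)] at h1
        convert h1 using 1
        ext v
        simp
        field_simp
      have h2 : HasFDerivAt (fun y : E => h (‖y‖, y)) ((fderiv ℝ h (‖y‖, y)).comp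
          ((‖y‖⁻¹ • innerSL ℝ y).prod (ContinuousLinearMap.id ℝ E))) y :=
        HasFDerivAt.comp (g := h) (f := fun y : E => (‖y‖, y)) y (hfd (‖y‖, y))
        (hn.prodMk (hasFDerivAt_id y))
      convert h2 using 1
      ext v
      have hny : ‖y‖ ≠ 0 := norm_ne_zero_iff.2 hy
      simp only [hh', add_apply, ContinuousLinearMap.comp_apply,
        ContinuousLinearMap.inr_apply, ContinuousLinearMap.smulRight_apply,
        ContinuousLinearMap.prod_apply, smul_apply]
      rw [hsplit _ (_ • _), hkey, smul_smul, add_comm]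
      congr 2
      simp
      field_simp

/-- Proposition A.1 (k = ∞): a function `φ` on `E = ℝ³` is the restriction to the
light-cone of a smooth spacetime function iff it is cone-smooth, i.e. of the form
`φ(y) = f(y) + ‖y‖·g(y)` with `f, g` smooth. -/
theorem cone_smooth_iff_extension (φ : EuclideanSpace ℝ (Fin 3) → ℝ) :
    (∃ F : ℝ × EuclideanSpace ℝ (Fin 3) → ℝ, ContDiff ℝ (⊤ : ℕ∞) F ∧
      ∀ y : EuclideanSpace ℝ (Fin 3), φ y = F (‖y‖, y)) ↔
    (∃ f g : EuclideanSpace ℝ (Fin 3) → ℝ,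
      ContDiff ℝ (⊤ : ℕ∞) f ∧ ContDiff ℝ (⊤ : ℕ∞) g ∧
      ∀ y : EuclideanSpace ℝ (Fin 3), φ y = f y + ‖y‖ * g y) := by
  constructor
  · rintro ⟨F, hF, hφ⟩
    have hF' : ContDiff ℝ (⊤ : ℕ∞)
        (fun p : ℝ × EuclideanSpace ℝ (Fin 3) => F (-p.1, p.2)) :=
      hF.comp (by fun_prop)
    obtain ⟨k, hk, hkeven, hkey⟩ := cone_hadamard
      (fun p : ℝ × EuclideanSpace ℝ (Fin 3) => (1 / 2 : ℝ) * (F p - F (-p.1, p.2)))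
      (contDiff_const.mul (hF.sub hF')) (by intro t y; simp; ring)
    refine ⟨fun y => (1 / 2 : ℝ) * (F (‖y‖, y) + F (-‖y‖, y)), fun y => k (‖y‖, y), ?_, ?_, ?_⟩
    · exact contDiff_infty.2 fun n => cone_even n
        (fun p : ℝ × EuclideanSpace ℝ (Fin 3) => (1 / 2 : ℝ) * (F p + F (-p.1, p.2)))
        (contDiff_const.mul (hF.add hF')) (by intro t y; simp; ring)
    · exact contDiff_infty.2 fun n => cone_even n k hk hkeven
    · intro y
      have := hkey ‖y‖ y
      simp only [smul_eq_mul] at this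
      rw [← this, hφ]
      ring
  · rintro ⟨f, g, hf, hg, hφ⟩
    refine ⟨fun p => f p.2 + p.1 * g p.2, ?_, hφ⟩
    exact (hf.comp contDiff_snd).add (contDiff_fst.mul (hg.comp contDiff_snd))
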